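/- arXiv:1606.06730 — 2 statements merged into one kernel-verified Lean document; each statement's English description precedes it below -/
import Mathlib

section
/- Let t, k, v be integers with k ≥ 2t, t ≥ 2, v ≥ 2. Then CAN(t,k,v) ≤ (log(C(k,t) − C(k−t,t)) + t·log v + 1) / log(v^t/(v^t−1)). (Godbole–Skipper–Sunley / Lovász local lemma bound.) -/
open scoped Classical

/-- `A` is a covering array of strength `t`. -/
def IsCoveringArray {N k v : ℕ} (t : ℕ) (A : Fin N → Fin k → Fin v) : Prop :=
  ∀ c : Fin t → Fin k, Function.Injective c → ∀ a : Fin t → Fin v,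
    ∃ r : Fin N, ∀ i : Fin t, A r (c i) = a i

/-- `CAN t k v` is the minimum number of rows of a covering array `CA(N; t, k, v)`. -/
noncomputable def CAN (t k v : ℕ) : ℕ :=
  sInf {N : ℕ | ∃ A : Fin N → Fin k → Fin v, IsCoveringArray t A}

open Finset in
/-- The lopsided symmetric Lovász local lemma for the uniform measure on a finite type. -/
theorem exists_forall_not_of_local_lemma {Ω ι : Type*} [Fintype Ω] [Nonempty Ω]
    (bad : ι → Ω → Prop) (Γ : ι → Finset ι) (p : ℝ) (d : ℕ) (hd : 1 ≤ d) (hp : 0 ≤ p)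
    (hΓ : ∀ i, #(Γ i) ≤ d) (hpd : Real.exp 1 * p * (d + 1) ≤ 1)
    (hind : ∀ i (T : Finset ι), i ∉ T → Disjoint T (Γ i) →
      (#{ω | bad i ω ∧ ∀ j ∈ T, ¬ bad j ω} : ℝ) ≤ p * #{ω | ∀ j ∈ T, ¬ bad j ω})
    (T : Finset ι) : ∃ ω, ∀ j ∈ T, ¬ bad j ω := by
  set N : Finset ι → ℝ := fun T => #{ω | ∀ j ∈ T, ¬ bad j ω} with hN
  set B : ι → Finset ι → ℝ := fun i T => #{ω | bad i ω ∧ ∀ j ∈ T, ¬ bad j ω} with hB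
  have hd' : (1 : ℝ) ≤ d := by exact_mod_cast hd
  set x : ℝ := 1 / (d + 1) with hx
  have hx0 : 0 < x := by positivity
  have hx1 : x < 1 := by
    rw [hx, div_lt_one (by positivity)]; linarith
  have hinsert (i : ι) (T : Finset ι) : N (insert i T) = N T - B i T := by
    have h := card_filter_add_card_filter_not (s := ({ω | ∀ j ∈ T, ¬ bad j ω} : Finset Ω))
      (fun ω => bad i ω)
    rw [filter_filter, filter_filter] at h
    simp only [hN, hB, forall_mem_insert]
    rw [← h]
    push_cast
    simp only [and_comm]
    ring
  have hpx : p ≤ x * (1 - x) ^ d := by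
    have h1 : (1 + 1 / (d : ℝ)) ^ d ≤ Real.exp 1 := by
      calc (1 + 1 / (d : ℝ)) ^ d ≤ (Real.exp (1 / d)) ^ d := by
            gcongr
            rw [add_comm]
            exact Real.add_one_le_exp _
        _ = Real.exp 1 := by
            rw [← Real.exp_nat_mul]
            congr 1
            field_simp
    have h2 : (1 - x) = (1 + 1 / (d : ℝ))⁻¹ := by
      rw [hx]; field_simp; ring
    rw [h2, inv_pow, hx, ← one_div, div_mul_div_comm, one_mul, le_div_iff₀ (by positivity)]
    calc p * ((d + 1) * (1 + 1 / (d : ℝ)) ^ d) ≤ p * ((d + 1) * Real.exp 1) := by gcongr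
      _ ≤ 1 := by linarith
  have hmono (i : ι) {S T : Finset ι} (hST : S ⊆ T) : B i T ≤ B i S := by
    simp only [hB, Nat.cast_le]
    exact card_le_card fun ω => by
      simp only [mem_filter, mem_univ, true_and]
      exact fun h => ⟨h.1, fun j hj => h.2 j (hST hj)⟩
  have key : ∀ T : Finset ι, ∀ i ∉ T, B i T ≤ x * N T := by
    intro T
    induction T using Finset.strongInduction with
    | H T ih =>
      intro i hi
      set T₂ := T \ Γ i with hT₂
      have hgrow : ∀ U ⊆ T ∩ Γ i, (1 - x) ^ #U * N T₂ ≤ N (U ∪ T₂) := by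
        intro U
        induction U using Finset.induction_on with
        | empty => simp
        | insert a U ha ihU =>
          intro hU
          have haT := hU (mem_insert_self a U)
          have hUT := (subset_insert a U).trans hU
          have hnot : a ∉ U ∪ T₂ := by
            simp [ha, hT₂, (mem_inter.1 haT).2]
          have hss : U ∪ T₂ ⊂ T :=
            (ssubset_iff_of_subset (union_subset (hUT.trans inter_subset_left)
              sdiff_subset)).2 ⟨a, (mem_inter.1 haT).1, hnot⟩
          have h1 := ih _ hss a hnot
          rw [insert_union, hinsert, card_insert_of_notMem ha, pow_succ]
          have h2 := mul_le_mul_of_nonneg_left (ihU hUT) (sub_nonneg.2 hx1.le)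
          linarith
      have hsplit : T ∩ Γ i ∪ T₂ = T := by
        rw [union_comm]; exact sdiff_union_inter T (Γ i)
      have h1 := hgrow _ subset_rfl
      rw [hsplit] at h1
      have hN0 : 0 ≤ N T₂ := Nat.cast_nonneg _
      calc B i T ≤ B i T₂ := hmono i sdiff_subset
        _ ≤ p * N T₂ := hind i T₂ (fun h => hi (sdiff_subset h)) sdiff_disjoint
        _ ≤ x * (1 - x) ^ d * N T₂ := by gcongr
        _ ≤ x * (1 - x) ^ #(T ∩ Γ i) * N T₂ := by
          have : (1 - x) ^ d ≤ (1 - x) ^ #(T ∩ Γ i) :=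
            pow_le_pow_of_le_one (by linarith) (by linarith)
              ((card_le_card inter_subset_right).trans (hΓ i))
          gcongr
        _ ≤ x * N T := by
          rw [mul_assoc]; gcongr
  have hpos : 0 < N T := by
    induction T using Finset.induction_on with
    | empty => simp [hN, Fintype.card_pos]
    | insert a U ha ih =>
      rw [hinsert]
      nlinarith [key U a ha]
  have : 0 < #{ω | ∀ j ∈ T, ¬ bad j ω} := Nat.cast_pos.1 hpos
  obtain ⟨ω, hω⟩ := card_pos.1 this
  exact ⟨ω, (mem_filter.1 hω).2⟩

open Finset in
/-- Events determined by complementary sets of coordinates are independent. -/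
theorem card_filter_and_mul_card_pi {κ X : Type*} [Fintype κ] [Fintype X]
    (S : Finset κ) (P Q : (κ → X) → Prop)
    (hP : ∀ f g : κ → X, (∀ i ∈ S, f i = g i) → P f → P g)
    (hQ : ∀ f g : κ → X, (∀ i ∉ S, f i = g i) → Q f → Q g) :
    #{f | P f ∧ Q f} * Fintype.card (κ → X) = #{f | P f} * #{f | Q f} := by
  rw [← card_univ, ← card_product, ← card_product]
  refine card_nbij' (fun fg => (S.piecewise fg.1 fg.2, S.piecewise fg.2 fg.1))
    (fun fg => (S.piecewise fg.1 fg.2, S.piecewise fg.2 fg.1)) ?_ ?_ ?_ ?_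
  · rintro ⟨f, g⟩ h
    simp only [coe_product, Set.mem_prod, mem_coe, mem_filter, mem_univ, true_and, and_true] at h ⊢
    exact ⟨hP f _ (fun i hi => by simp [hi]) h.1, hQ f _ (fun i hi => by simp [hi]) h.2⟩
  · rintro ⟨f, g⟩ h
    simp only [coe_product, Set.mem_prod, mem_coe, mem_filter, mem_univ, true_and, and_true] at h ⊢
    exact ⟨hP f _ (fun i hi => by simp [hi]) h.1, hQ g _ (fun i hi => by simp [hi]) h.2⟩
  all_goals
    rintro ⟨f, g⟩ -
    refine Prod.ext ?_ ?_ <;> funext i <;> by_cases hi : i ∈ S <;> simp [hi]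

/-- Some pattern on the columns in `S` is not covered by any translate of a row of `f`, where
`f i r` is the entry in row `r` and column `i`. -/
def MissesPattern {κ G : Type*} [Add G] {n : ℕ} (S : Finset κ) (f : κ → Fin n → G) : Prop :=
  ∃ a : κ → G, ∀ r j, ∃ i ∈ S, f i r + j ≠ a i

open Finset in
theorem card_filter_exists_translate {κ G : Type*} [Fintype κ] [Fintype G] [AddGroup G]
    {S : Finset κ} (hS : S.Nonempty) (a : κ → G) :
    #{x : κ → G | ∃ j, ∀ i ∈ S, x i + j = a i} =
      Fintype.card G * Fintype.card G ^ (Fintype.card κ - #S) := by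
  have h : ({x : κ → G | ∃ j, ∀ i ∈ S, x i + j = a i} : Finset (κ → G)) =
      univ.biUnion fun j => Fintype.piFinset fun i => if i ∈ S then {a i - j} else univ := by
    ext x
    simp only [mem_filter, mem_univ, true_and, mem_biUnion, Fintype.mem_piFinset]
    refine exists_congr fun j => forall_congr' fun i => ?_
    by_cases hi : i ∈ S <;> simp [hi, eq_sub_iff_add_eq]
  rw [h, card_biUnion]
  · have h2 (j : G) : #(Fintype.piFinset fun i => if i ∈ S then {a i - j} else univ) =
        Fintype.card G ^ (Fintype.card κ - #S) := by
      rw [Fintype.card_piFinset, ← card_compl, ← prod_const, ← prod_mul_prod_compl S]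
      rw [prod_eq_one fun i hi => by simp [hi], one_mul]
      exact prod_congr rfl fun i hi => by simp [mem_compl.1 hi]
    simp [h2]
  · intro j _ j' _ hjj'
    rw [Function.onFun, disjoint_left]
    intro x hx hx'
    obtain ⟨i, hi⟩ := hS
    rw [Fintype.mem_piFinset] at hx hx'
    have h1 := hx i
    have h2 := hx' i
    simp only [hi, if_true, mem_singleton] at h1 h2
    exact hjj' (sub_right_injective (h1.symm.trans h2))

open Finset in
theorem card_filter_missesPattern_le {κ G : Type*} [Fintype κ] [Fintype G] [AddGroup G] {n : ℕ}
    {S : Finset κ} (hS : S.Nonempty) :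
    (#{f : κ → Fin n → G | MissesPattern S f} : ℝ) ≤
      (Fintype.card G : ℝ) ^ (#S - 1) * (1 - 1 / (Fintype.card G : ℝ) ^ (#S - 1)) ^ n *
        Fintype.card (κ → Fin n → G) := by
  set v := Fintype.card G with hv
  have hv0 : (0 : ℝ) < v := by exact_mod_cast Fintype.card_pos
  have hS1 : 1 ≤ #S := hS.card_pos
  have hSκ : #S ≤ Fintype.card κ := card_le_univ S
  have hrow (a : κ → G) : (#{x : κ → G | ∀ j, ∃ i ∈ S, x i + j ≠ a i} : ℝ) =
      (1 - 1 / (v : ℝ) ^ (#S - 1)) * v ^ Fintype.card κ := by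
    have h := card_filter_add_card_filter_not (s := (univ : Finset (κ → G)))
      (fun x => ∃ j, ∀ i ∈ S, x i + j = a i)
    rw [card_filter_exists_translate hS, card_univ, Fintype.card_fun] at h
    push Not at h
    have h' : (v : ℝ) * v ^ (Fintype.card κ - #S) +
        #{x : κ → G | ∀ j, ∃ i ∈ S, x i + j ≠ a i} = v ^ Fintype.card κ := by exact_mod_cast h
    have h3 : (v : ℝ) ^ Fintype.card κ = v ^ (#S - 1) * (v * v ^ (Fintype.card κ - #S)) := by
      rw [← pow_succ', ← pow_add]; congr 1; omega
    rw [sub_mul, one_mul, ← h']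
    rw [← h'] at h3
    rw [h3]
    field_simp
    linarith
  have hfix (a : κ → G) : (#{f : κ → Fin n → G | ∀ r j, ∃ i ∈ S, f i r + j ≠ a i} : ℝ) =
      (1 - 1 / (v : ℝ) ^ (#S - 1)) ^ n * Fintype.card (κ → Fin n → G) := by
    have h : #{f : κ → Fin n → G | ∀ r j, ∃ i ∈ S, f i r + j ≠ a i} =
        #(Fintype.piFinset fun _ : Fin n => ({x : κ → G | ∀ j, ∃ i ∈ S, x i + j ≠ a i} :
          Finset (κ → G))) := by
      refine card_nbij' (fun f r i => f i r) (fun g i r => g r i) ?_ ?_ ?_ ?_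
      · intro f hf
        simpa [Fintype.mem_piFinset] using hf
      · intro f hf
        simpa [Fintype.mem_piFinset] using hf
      · intro f _; rfl
      · intro f _; rfl
    rw [h, Fintype.card_piFinset, prod_const, card_univ, Fintype.card_fin, Nat.cast_pow, hrow,
      mul_pow, Fintype.card_fun, Fintype.card_fun, Fintype.card_fin]
    push_cast
    rw [← hv, ← pow_mul, ← pow_mul, mul_comm n]
  obtain ⟨i₀, hi₀⟩ := hS
  set R : Finset (κ → G) :=
    Fintype.piFinset fun i => if i ∈ S.erase i₀ then univ else {0} with hR
  have hRcard : #R = v ^ (#S - 1) := by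
    rw [hR, Fintype.card_piFinset, ← card_erase_of_mem hi₀, ← prod_const,
      ← prod_mul_prod_compl (S.erase i₀)]
    rw [prod_congr (s₁ := (S.erase i₀)ᶜ) rfl fun i hi => by rw [if_neg (mem_compl.1 hi)]]
    rw [prod_congr (s₁ := S.erase i₀) rfl fun i hi => by rw [if_pos hi]]
    simp [hv]
  have hsub : ({f : κ → Fin n → G | MissesPattern S f} : Finset _) ⊆
      R.biUnion fun a => {f : κ → Fin n → G | ∀ r j, ∃ i ∈ S, f i r + j ≠ a i} := by
    intro f hf
    obtain ⟨a, ha⟩ := (mem_filter.1 hf).2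
    refine mem_biUnion.2 ⟨fun i => if i ∈ S then a i - a i₀ else 0, ?_, ?_⟩
    · rw [hR, Fintype.mem_piFinset]
      intro i
      by_cases hi : i ∈ S <;> by_cases hii : i = i₀ <;> simp [hi, hii]
    · simp only [mem_filter, mem_univ, true_and]
      intro r j
      obtain ⟨i, hi, h⟩ := ha r (j + a i₀)
      refine ⟨i, hi, ?_⟩
      rw [if_pos hi, Ne, eq_sub_iff_add_eq, add_assoc]
      exact h
  calc (#{f : κ → Fin n → G | MissesPattern S f} : ℝ)
      ≤ ((∑ a ∈ R, #{f : κ → Fin n → G | ∀ r j, ∃ i ∈ S, f i r + j ≠ a i} : ℕ) : ℝ) := by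
        exact_mod_cast (card_le_card hsub).trans card_biUnion_le
    _ = _ := by
        push_cast
        simp only [hfix, sum_const, hRcard, nsmul_eq_mul]
        push_cast
        ring

open Finset in
theorem card_filter_ne_and_not_disjoint {k t : ℕ} (ht : 1 ≤ t)
    (S : {S : Finset (Fin k) // #S = t}) :
    #{S' : {S : Finset (Fin k) // #S = t} | S' ≠ S ∧ ¬ Disjoint S'.1 S.1} + 1 +
      (k - t).choose t = k.choose t := by
  have h1 : #{S' : {S : Finset (Fin k) // #S = t} | Disjoint S'.1 S.1} = (k - t).choose t := by
    have h : #(S.1ᶜ) = k - t := by rw [card_compl, S.2, Fintype.card_fin]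
    rw [← h, ← card_powersetCard]
    refine card_bij (fun S' _ => S'.1) ?_ ?_ ?_
    · intro S' hS'
      rw [mem_powersetCard]
      exact ⟨subset_compl_iff_disjoint_right.2 (mem_filter.1 hS').2, S'.2⟩
    · intro a _ b _ h
      exact Subtype.ext h
    · intro b hb
      rw [mem_powersetCard] at hb
      exact ⟨⟨b, hb.2⟩, by simpa using subset_compl_iff_disjoint_right.1 hb.1, rfl⟩
  have h2 := card_filter_add_card_filter_not
    (s := (univ : Finset {S : Finset (Fin k) // #S = t})) (fun S' => Disjoint S'.1 S.1)
  rw [h1, card_univ, Fintype.card_finset_len, Fintype.card_fin] at h2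
  have h3 : ({S' : {S : Finset (Fin k) // #S = t} | S' ≠ S ∧ ¬ Disjoint S'.1 S.1} : Finset _) =
      ({S' : {S : Finset (Fin k) // #S = t} | ¬ Disjoint S'.1 S.1} : Finset _).erase S := by
    ext S'; simp
  have hSS : ¬ Disjoint S.1 S.1 := by
    rw [disjoint_self_iff_empty, ← card_eq_zero, S.2]; omega
  rw [h3, card_erase_add_one (by simpa using hSS)]
  omega

open Finset in
/-- The local lemma applied to arrays obtained by developing `n` random rows over a group. -/
theorem exists_forall_not_missesPattern {k t n : ℕ} {G : Type*} [Fintype G] [AddGroup G]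
    (ht : 1 ≤ t) (hk : (k - t).choose t + 2 ≤ k.choose t)
    (hn : Real.exp 1 * ((Fintype.card G : ℝ) ^ (t - 1) *
      (1 - 1 / (Fintype.card G : ℝ) ^ (t - 1)) ^ n) *
        ((k.choose t : ℝ) - ((k - t).choose t : ℝ)) ≤ 1) :
    ∃ f : Fin k → Fin n → G, ∀ S : Finset (Fin k), #S = t → ¬ MissesPattern S f := by
  have hv1 : (1 : ℝ) ≤ Fintype.card G := by exact_mod_cast Fintype.card_pos (α := G)
  have hq : 0 ≤ 1 - 1 / (Fintype.card G : ℝ) ^ (t - 1) := by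
    rw [sub_nonneg, div_le_one (by positivity)]
    exact one_le_pow₀ hv1
  obtain ⟨f, hf⟩ := exists_forall_not_of_local_lemma
    (fun (S : {S : Finset (Fin k) // #S = t}) (f : Fin k → Fin n → G) => MissesPattern S.1 f)
    (fun S => {S' | S' ≠ S ∧ ¬ Disjoint S'.1 S.1})
    ((Fintype.card G : ℝ) ^ (t - 1) * (1 - 1 / (Fintype.card G : ℝ) ^ (t - 1)) ^ n)
    (k.choose t - (k - t).choose t - 1) (by omega) (by positivity)
    (fun S => by have := card_filter_ne_and_not_disjoint ht S; omega)
    (by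
      rw [Nat.sub_sub, Nat.cast_sub (by omega)]
      push_cast
      convert hn using 2
      ring)
    (fun S T hST hT => by
      have hS : S.1.Nonempty := card_pos.1 (by rw [S.2]; omega)
      have h1 := card_filter_missesPattern_le (G := G) (n := n) hS
      have h2 := card_filter_and_mul_card_pi S.1 (fun f : Fin k → Fin n → G => MissesPattern S.1 f)
        (fun f => ∀ S' ∈ T, ¬ MissesPattern S'.1 f)
        (by
          rintro f g hfg ⟨a, ha⟩
          refine ⟨a, fun r j => ?_⟩
          obtain ⟨i, hi, h⟩ := ha r j
          exact ⟨i, hi, hfg i hi ▸ h⟩)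
        (by
          rintro f g hfg hf S' hS' ⟨a, ha⟩
          refine hf S' hS' ⟨a, fun r j => ?_⟩
          obtain ⟨i, hi, h⟩ := ha r j
          have hdisj : Disjoint S'.1 S.1 := by
            by_contra hcon
            exact disjoint_left.1 hT hS' (by
              simp only [mem_filter, mem_univ, true_and]
              exact ⟨fun he => hST (he ▸ hS'), hcon⟩)
          exact ⟨i, hi, by rw [hfg i (disjoint_left.1 hdisj hi)]; exact h⟩)
      rw [S.2] at h1
      have hpos : (0 : ℝ) < Fintype.card (Fin k → Fin n → G) := by
        exact_mod_cast Fintype.card_pos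
      refine le_of_mul_le_mul_right ?_ hpos
      rw [mul_right_comm]
      refine le_trans (le_of_eq ?_) (mul_le_mul_of_nonneg_right
        (b := (#{f : Fin k → Fin n → G | MissesPattern S.1 f} : ℝ)) ?_ (Nat.cast_nonneg _))
      · rw [← Nat.cast_mul, ← Nat.cast_mul]
        congr 1
        convert h2
      · convert h1 using 1 <;> congr!)
    univ
  exact ⟨f, fun S hS => hf ⟨S, hS⟩ (mem_univ _)⟩

open Finset in
theorem CAN_le_mul_of_forall_not_missesPattern {t k v n : ℕ} [NeZero v]
    (f : Fin k → Fin n → Fin v) (hf : ∀ S : Finset (Fin k), #S = t → ¬ MissesPattern S f) :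
    CAN t k v ≤ n * v := by
  refine Nat.sInf_le ⟨fun r i => f i (finProdFinEquiv.symm r).1 + (finProdFinEquiv.symm r).2, ?_⟩
  intro c hc a
  have h := hf (univ.image c) (by rw [card_image_of_injective _ hc, card_univ, Fintype.card_fin])
  unfold MissesPattern at h
  push Not at h
  obtain ⟨r, j, h⟩ := h (Function.extend c a 0)
  refine ⟨finProdFinEquiv (r, j), fun i => ?_⟩
  simp only [Equiv.symm_apply_apply]
  rw [h (c i) (mem_image_of_mem c (mem_univ i)), hc.extend_apply]

theorem choose_sub_add_two_le_choose {t k : ℕ} (ht : 2 ≤ t) (hk : 2 * t ≤ k) :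
    (k - t).choose t + 2 ≤ k.choose t := by
  obtain ⟨m, rfl⟩ : ∃ m, k = m + 2 := ⟨k - 2, by omega⟩
  obtain ⟨s, rfl⟩ : ∃ s, t = s + 1 := ⟨t - 1, by omega⟩
  have h1 : (m + 2 - (s + 1)).choose (s + 1) ≤ m.choose (s + 1) :=
    Nat.choose_le_choose _ (by omega)
  have h2 : 0 < m.choose s := Nat.choose_pos (by omega)
  have h3 : 0 < (m + 1).choose s := Nat.choose_pos (by omega)
  rw [Nat.choose_succ_succ' (m + 1), Nat.choose_succ_succ' m]
  omega

/-- Godbole–Skipper–Sunley (Lovász local lemma) bound: for `k ≥ 2t`, `t, v ≥ 2`,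
`CAN(t,k,v) ≤ (log(C(k,t) − C(k−t,t)) + t log v + 1) / log (v^t/(v^t−1))`. -/
theorem gss_bound (t k v : ℕ) (ht : 2 ≤ t) (hk : 2 * t ≤ k) (hv : 2 ≤ v) :
    (CAN t k v : ℝ) ≤
      (Real.log ((k.choose t : ℝ) - ((k - t).choose t : ℝ)) + t * Real.log v + 1) /
        Real.log ((v : ℝ) ^ t / ((v : ℝ) ^ t - 1)) := by
  have : NeZero v := ⟨by omega⟩
  have hchoose := choose_sub_add_two_le_choose ht hk
  set D : ℝ := (k.choose t : ℝ) - ((k - t).choose t : ℝ) with hD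
  have hD1 : 1 ≤ D := by
    have : ((k - t).choose t : ℝ) + 2 ≤ k.choose t := by exact_mod_cast hchoose
    linarith
  have hv2 : (2 : ℝ) ≤ v := by exact_mod_cast hv
  obtain ⟨s, rfl⟩ : ∃ s, t = s + 1 := ⟨t - 1, by omega⟩
  have hvs : (v : ℝ) ≤ v ^ s := le_self_pow₀ (by linarith) (by omega)
  have hvt : (1 : ℝ) < v ^ (s + 1) := one_lt_pow₀ (by linarith) (by omega)
  set q : ℝ := 1 - 1 / (v : ℝ) ^ s with hq
  set q' : ℝ := 1 - 1 / (v : ℝ) ^ (s + 1) with hq'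
  have hinv : 1 / (v : ℝ) ^ s ≤ 1 / v := one_div_le_one_div_of_le (by linarith) hvs
  have hinv2 : 1 / (v : ℝ) ≤ 1 / 2 := one_div_le_one_div_of_le (by norm_num) hv2
  have hq0 : 0 < q := by rw [hq]; linarith
  have hq1 : q < 1 := by rw [hq]; linarith [show 0 < 1 / (v : ℝ) ^ s by positivity]
  have hq'0 : 0 < q' := by
    rw [hq', sub_pos, div_lt_one (by positivity)]; exact hvt
  have hq'1 : q' < 1 := by rw [hq']; linarith [show 0 < 1 / (v : ℝ) ^ (s + 1) by positivity]
  have hbern : q ≤ q' ^ v := by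
    have h := one_add_mul_le_pow (a := -(1 / (v : ℝ) ^ (s + 1))) (by linarith) v
    rw [← sub_eq_add_neg] at h
    refine le_trans (le_of_eq ?_) h
    rw [hq, pow_succ]
    field_simp
    ring
  have hL : Real.log ((v : ℝ) ^ (s + 1) / ((v : ℝ) ^ (s + 1) - 1)) = -Real.log q' := by
    rw [← Real.log_inv, hq']
    congr 1
    field_simp
  have hlq : Real.log q < 0 := Real.log_neg hq0 hq1
  have hlq' : Real.log q' < 0 := Real.log_neg hq'0 hq'1
  have hLL : Real.log q ≤ v * Real.log q' := by
    rw [← Real.log_pow]; exact Real.log_le_log hq0 hbern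
  have hqv : -Real.log v ≤ Real.log q := by
    rw [← Real.log_inv, ← one_div]
    exact Real.log_le_log (by positivity) (by rw [hq]; linarith)
  set Y : ℝ := Real.log D + s * Real.log v + 1 with hY
  have hY0 : 0 ≤ Y := by
    have := Real.log_nonneg hD1
    have := Real.log_nonneg (show (1 : ℝ) ≤ v by linarith)
    positivity
  set n := ⌈Y / (-Real.log q)⌉₊ with hn
  have hn1 : Y ≤ n * (-Real.log q) := by
    rw [← div_le_iff₀ (by linarith)]; exact Nat.le_ceil _
  have hn2 : (n : ℝ) < Y / (-Real.log q) + 1 := Nat.ceil_lt_add_one (by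
    apply div_nonneg hY0; linarith)
  have hcond : Real.exp 1 * ((v : ℝ) ^ s * q ^ n) * D ≤ 1 := by
    rw [← Real.log_nonpos_iff (by positivity), Real.log_mul (by positivity) (by positivity),
      Real.log_mul (by positivity) (by positivity), Real.log_mul (by positivity) (by positivity),
      Real.log_exp, Real.log_pow, Real.log_pow]
    linarith
  obtain ⟨f, hf⟩ := exists_forall_not_missesPattern (k := k) (t := s + 1) (n := n) (G := Fin v)
    (by omega) hchoose (by simpa [hq, hD] using hcond)
  have hCAN : (CAN (s + 1) k v : ℝ) ≤ n * v := by
    exact_mod_cast CAN_le_mul_of_forall_not_missesPattern f hf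
  rw [hL, le_div_iff₀ (by linarith)]
  have hn3 : n * (-Real.log q) ≤ Y + -Real.log q := by
    have h := mul_le_mul_of_nonneg_right hn2.le (show 0 ≤ -Real.log q by linarith)
    rwa [add_mul, div_mul_cancel₀ _ (by linarith), one_mul] at h
  calc (CAN (s + 1) k v : ℝ) * -Real.log q' ≤ n * v * -Real.log q' := by
        apply mul_le_mul_of_nonneg_right hCAN; linarith
    _ = n * (v * -Real.log q') := by ring
    _ ≤ n * -Real.log q := by gcongr; linarith
    _ ≤ Y + -Real.log q := hn3
    _ ≤ Real.log D + ((s + 1 : ℕ) : ℝ) * Real.log v + 1 := by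
        rw [hY]; push_cast; linarith
end

section
/- Fix t ≥ 2, v ≥ 2 constant, and let X_k denote the number of uncovered t-way interactions in a random n(k) × k array with i.i.d. uniform entries over a v-ary alphabet, where n(k) is chosen so that E[X_k] = C(k,t)·v^t·(1−1/v^t)^{n(k)} → ∞ as k → ∞. Then X_k / E[X_k] → 1 in probability as k → ∞. -/
open scoped Classical

/-- A `t`-way interaction: a strictly increasing choice of `t` of the `k` columns,
together with an assignment of a symbol to each chosen column. -/
abbrev Interaction (t k v : ℕ) : Type :=
  {c : Fin t → Fin k // StrictMono c} × (Fin t → Fin v)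

/-- The interaction `ι` is not covered by the array `A`. -/
def Uncovered {t k v n : ℕ} (A : Fin n → Fin k → Fin v) (ι : Interaction t k v) : Prop :=
  ¬ ∃ r : Fin n, ∀ i : Fin t, A r (ι.1.1 i) = ι.2 i

open Finset

/-- Functions agreeing with `g` on `S`. -/
lemma card_agree_mul {k v : ℕ} (S : Finset (Fin k)) (g : Fin k → Fin v) :
    (univ.filter fun f : Fin k → Fin v => ∀ i ∈ S, f i = g i).card * v ^ S.card = v ^ k := by
  have h : (univ.filter fun f : Fin k → Fin v => ∀ i ∈ S, f i = g i) =
      Fintype.piFinset fun i => if i ∈ S then {g i} else univ := by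
    ext f
    simp only [mem_filter, mem_univ, true_and, Fintype.mem_piFinset]
    refine forall_congr' fun i => ?_
    by_cases hi : i ∈ S <;> simp [hi]
  have h2 : ∀ i, (if i ∈ S then ({g i} : Finset (Fin v)) else univ).card =
      if i ∈ S then 1 else v := by
    intro i; split_ifs <;> simp
  rw [h, Fintype.card_piFinset, prod_congr rfl fun i _ => h2 i, prod_ite]
  simp only [prod_const_one, one_mul, prod_const]
  rw [← pow_add]
  congr 1
  have := card_filter_add_card_filter_not (s := (univ : Finset (Fin k))) (fun i => i ∈ S)
  simp at this ⊢
  omega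

/-- The array row `f` covers the interaction `ι`. -/
def RowCovers {t k v : ℕ} (f : Fin k → Fin v) (ι : Interaction t k v) : Prop :=
  ∀ i : Fin t, f (ι.1.1 i) = ι.2 i

/-- The columns involved in an interaction. -/
def columns {t k v : ℕ} (ι : Interaction t k v) : Finset (Fin k) := univ.image ι.1.1

lemma card_columns {t k v : ℕ} (ι : Interaction t k v) : (columns ι).card = t := by
  rw [columns, card_image_of_injective _ ι.1.2.injective]; simp

lemma uncovered_iff {t k v n : ℕ} (A : Fin n → Fin k → Fin v) (ι : Interaction t k v) :
    Uncovered A ι ↔ ∀ r, ¬ RowCovers (A r) ι := by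
  simp [Uncovered, RowCovers]

lemma rowCovers_iff_agree {t k v : ℕ} {g : Fin k → Fin v} {ι : Interaction t k v}
    (hg : RowCovers g ι) (f : Fin k → Fin v) :
    RowCovers f ι ↔ ∀ i ∈ columns ι, f i = g i := by
  simp only [columns, mem_image, mem_univ, true_and, forall_exists_index,
    forall_apply_eq_imp_iff]
  exact forall_congr' fun i => by rw [hg i]

lemma exists_rowCovers {t k v : ℕ} (hv : 0 < v) (ι : Interaction t k v) :
    ∃ g : Fin k → Fin v, RowCovers g ι :=
  ⟨Function.extend ι.1.1 ι.2 fun _ => ⟨0, hv⟩, fun i => ι.1.2.injective.extend_apply _ _ i⟩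

lemma card_rowCovers {t k v : ℕ} (hv : 0 < v) (ι : Interaction t k v) :
    ((univ.filter fun f : Fin k → Fin v => RowCovers f ι).card : ℝ) =
      (v : ℝ) ^ k * (1 / (v : ℝ) ^ t) := by
  obtain ⟨g, hg⟩ := exists_rowCovers hv ι
  have h := card_agree_mul (columns ι) g
  simp only [← rowCovers_iff_agree hg] at h
  rw [card_columns] at h
  have hv' : (0 : ℝ) < v := by exact_mod_cast hv
  rw [mul_one_div, eq_div_iff (by positivity)]
  exact_mod_cast h

lemma card_rowCovers_both_le {t k v : ℕ} (hv : 0 < v) (ι κ : Interaction t k v) :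
    ((univ.filter fun f : Fin k → Fin v => RowCovers f ι ∧ RowCovers f κ).card : ℝ) ≤
      (v : ℝ) ^ k * ((1 / (v : ℝ) ^ t) ^ 2 * (v : ℝ) ^ (columns ι ∩ columns κ).card) := by
  have hv' : (0 : ℝ) < v := by exact_mod_cast hv
  by_cases hex : ∃ g : Fin k → Fin v, RowCovers g ι ∧ RowCovers g κ
  · obtain ⟨g, hg, hg'⟩ := hex
    have h := card_agree_mul (columns ι ∪ columns κ) g
    have hiff : ∀ f, (∀ i ∈ columns ι ∪ columns κ, f i = g i) ↔
        RowCovers f ι ∧ RowCovers f κ := by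
      intro f
      rw [rowCovers_iff_agree hg, rowCovers_iff_agree hg']
      simp only [mem_union, or_imp, forall_and]
    simp only [hiff] at h
    have hc := card_union_add_card_inter (columns ι) (columns κ)
    rw [card_columns, card_columns] at hc
    apply le_of_eq
    have h' : ((univ.filter fun f : Fin k → Fin v => RowCovers f ι ∧ RowCovers f κ).card : ℝ) *
        (v : ℝ) ^ (columns ι ∪ columns κ).card = (v : ℝ) ^ k := by exact_mod_cast h
    rw [← h']
    have e : (v : ℝ) ^ (columns ι ∪ columns κ).card * (v : ℝ) ^ (columns ι ∩ columns κ).card =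
        (v : ℝ) ^ t * (v : ℝ) ^ t := by rw [← pow_add, hc, pow_add]
    field_simp
    linear_combination -(univ.filter fun f : Fin k → Fin v =>
      RowCovers f ι ∧ RowCovers f κ).card * e
  · have : (univ.filter fun f : Fin k → Fin v => RowCovers f ι ∧ RowCovers f κ) = ∅ :=
      filter_eq_empty_iff.2 fun f _ hf => hex ⟨f, hf⟩
    rw [this]
    simp only [card_empty, Nat.cast_zero]
    positivity

lemma card_not_rowCovers {t k v : ℕ} (hv : 0 < v) (ι : Interaction t k v) :
    ((univ.filter fun f : Fin k → Fin v => ¬ RowCovers f ι).card : ℝ) =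
      (v : ℝ) ^ k * (1 - 1 / (v : ℝ) ^ t) := by
  have h := card_filter_add_card_filter_not (s := (univ : Finset (Fin k → Fin v)))
    (fun f => RowCovers f ι)
  have h1 := card_rowCovers hv ι
  have h2 : ((univ.filter fun f : Fin k → Fin v => RowCovers f ι).card : ℝ) +
      ((univ.filter fun f : Fin k → Fin v => ¬ RowCovers f ι).card : ℝ) = (v : ℝ) ^ k := by
    rw [← Nat.cast_add, h]; simp
  linarith

lemma card_not_rowCovers_both_le {t k v : ℕ} (hv : 0 < v) (ι κ : Interaction t k v) :
    ((univ.filter fun f : Fin k → Fin v => ¬ RowCovers f ι ∧ ¬ RowCovers f κ).card : ℝ) ≤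
      (v : ℝ) ^ k * (1 - 2 * (1 / (v : ℝ) ^ t) +
        (1 / (v : ℝ) ^ t) ^ 2 * (v : ℝ) ^ (columns ι ∩ columns κ).card) := by
  have h1 := card_rowCovers hv ι
  have h2 := card_rowCovers hv κ
  have h3 := card_rowCovers_both_le hv ι κ
  have hu := card_union_add_card_inter
    (univ.filter fun f : Fin k → Fin v => RowCovers f ι)
    (univ.filter fun f : Fin k → Fin v => RowCovers f κ)
  rw [← filter_or, ← filter_and] at hu
  have hn := card_filter_add_card_filter_not (s := (univ : Finset (Fin k → Fin v)))
    (fun f => RowCovers f ι ∨ RowCovers f κ)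
  simp only [not_or] at hn
  have hu' : ((univ.filter fun f : Fin k → Fin v => RowCovers f ι ∨ RowCovers f κ).card : ℝ) +
      ((univ.filter fun f : Fin k → Fin v => RowCovers f ι ∧ RowCovers f κ).card : ℝ) =
      ((univ.filter fun f : Fin k → Fin v => RowCovers f ι).card : ℝ) +
      ((univ.filter fun f : Fin k → Fin v => RowCovers f κ).card : ℝ) := by exact_mod_cast hu
  have hn' : ((univ.filter fun f : Fin k → Fin v => RowCovers f ι ∨ RowCovers f κ).card : ℝ) +
      ((univ.filter fun f : Fin k → Fin v => ¬ RowCovers f ι ∧ ¬ RowCovers f κ).card : ℝ) =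
      (v : ℝ) ^ k := by
    rw [← Nat.cast_add, hn]; simp
  linarith

lemma card_arrays_uncovered {t k v : ℕ} (hv : 0 < v) (n : ℕ) (ι : Interaction t k v) :
    ((univ.filter fun A : Fin n → Fin k → Fin v => Uncovered A ι).card : ℝ) =
      ((v : ℝ) ^ k) ^ n * (1 - 1 / (v : ℝ) ^ t) ^ n := by
  have h : (univ.filter fun A : Fin n → Fin k → Fin v => Uncovered A ι) =
      Fintype.piFinset fun _ => univ.filter fun f : Fin k → Fin v => ¬ RowCovers f ι := by
    ext A
    simp [uncovered_iff]
  rw [h, Fintype.card_piFinset_const, Nat.cast_pow, card_not_rowCovers hv, mul_pow]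

/-- Log-convexity of `j ↦ 1 - 2 p + p ^ 2 * v ^ j`, compared with its chord over `[0, t]`. -/
lemma both_rows_le_chord {t : ℕ} (ht : 0 < t) {v : ℝ} (hv : 0 < v) (hvt : 2 ≤ v ^ t) {z : ℝ}
    (hz : 0 ≤ z) (hzq : z ^ t * (1 - 1 / v ^ t) = 1) {j : ℕ} (hj : j ≤ t) :
    1 - 2 * (1 / v ^ t) + (1 / v ^ t) ^ 2 * v ^ j ≤ (1 - 1 / v ^ t) ^ 2 * z ^ j := by
  have hp : 1 / v ^ t ≤ 1 / 2 := one_div_le_one_div_of_le two_pos hvt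
  have hp0 : 0 < 1 / v ^ t := by positivity
  have hpv : 1 / v ^ t * v ^ t = 1 := by field_simp
  set p := 1 / v ^ t with hpdef
  rcases Nat.eq_zero_or_pos j with rfl | hj0
  · simp only [pow_zero, mul_one]
    linarith [sq_nonneg p, show (1 - p) ^ 2 = 1 - 2 * p + p ^ 2 by ring]
  have hq : 0 < 1 - p := by linarith
  set a := (1 - 2 * p) / (1 - p) ^ 2 with ha
  set b := p ^ 2 / (1 - p) ^ 2 with hb
  have ha0 : 0 ≤ a := div_nonneg (by linarith) (by positivity)
  have hb0 : 0 ≤ b := by positivity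
  have hab : a + b = 1 := by rw [ha, hb]; field_simp; ring
  have habt : a + b * v ^ t = z ^ t := by
    have h1 : z ^ t = 1 / (1 - p) := by rw [eq_div_iff hq.ne']; exact hzq
    have h2 : p ^ 2 * v ^ t = p := by linear_combination p * hpv
    rw [h1, ha, hb, div_mul_eq_mul_div, h2]
    field_simp
    ring
  have hs : (1 : ℝ) ≤ (t : ℝ) / j := by
    rw [le_div_iff₀ (by exact_mod_cast hj0)]; simpa using hj
  have hjR : (j : ℝ) ≠ 0 := by exact_mod_cast hj0.ne'
  have key := (convexOn_rpow hs).2 (Set.mem_Ici.2 zero_le_one)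
    (Set.mem_Ici.2 (pow_nonneg hv.le j)) ha0 hb0 hab
  simp only [smul_eq_mul, mul_one, Real.one_rpow] at key
  rw [← Real.rpow_natCast_mul hv.le, mul_div_cancel₀ _ hjR, Real.rpow_natCast, habt] at key
  have h0 : 0 ≤ a + b * v ^ j := by positivity
  have key2 : a + b * v ^ j ≤ z ^ j := by
    have h3 := pow_le_pow_left₀ (Real.rpow_nonneg h0 _) key j
    rw [← Real.rpow_mul_natCast h0, div_mul_cancel₀ _ hjR, Real.rpow_natCast, ← pow_mul,
      mul_comm t j, pow_mul] at h3
    exact le_of_pow_le_pow_left₀ ht.ne' (pow_nonneg hz j) h3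
  calc 1 - 2 * p + p ^ 2 * v ^ j = (1 - p) ^ 2 * (a + b * v ^ j) := by
        rw [ha, hb]; field_simp
    _ ≤ _ := mul_le_mul_of_nonneg_left key2 (by positivity)

lemma card_arrays_uncovered_both_le {t k v : ℕ} (ht : 0 < t) (hv : 2 ≤ v) (n : ℕ) {z : ℝ}
    (hz : 0 ≤ z) (hzq : z ^ t * (1 - 1 / (v : ℝ) ^ t) = 1) (ι κ : Interaction t k v) :
    ((univ.filter fun A : Fin n → Fin k → Fin v => Uncovered A ι ∧ Uncovered A κ).card : ℝ) ≤
      ((v : ℝ) ^ k) ^ n * ((1 - 1 / (v : ℝ) ^ t) ^ n) ^ 2 *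
        (z ^ n) ^ (columns ι ∩ columns κ).card := by
  have hvR : (2 : ℝ) ≤ v := by exact_mod_cast hv
  have hvt : (2 : ℝ) ≤ (v : ℝ) ^ t := hvR.trans (le_self_pow₀ (by linarith) ht.ne')
  have hj : (columns ι ∩ columns κ).card ≤ t :=
    (card_le_card inter_subset_left).trans (card_columns ι).le
  have h : (univ.filter fun A : Fin n → Fin k → Fin v => Uncovered A ι ∧ Uncovered A κ) =
      Fintype.piFinset fun _ =>
        univ.filter fun f : Fin k → Fin v => ¬ RowCovers f ι ∧ ¬ RowCovers f κ := by
    ext A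
    simp [uncovered_iff, forall_and]
  rw [h, Fintype.card_piFinset_const, Nat.cast_pow]
  calc _ ≤ ((v : ℝ) ^ k * ((1 - 1 / (v : ℝ) ^ t) ^ 2 * z ^ (columns ι ∩ columns κ).card)) ^ n := by
        refine pow_le_pow_left₀ (Nat.cast_nonneg _) ?_ n
        refine (card_not_rowCovers_both_le (by omega) ι κ).trans ?_
        exact mul_le_mul_of_nonneg_left
          (both_rows_le_chord ht (by linarith) hvt hz hzq hj) (by positivity)
    _ = _ := by generalize 1 - 1 / (v : ℝ) ^ t = q; ring

lemma card_subtype_strictMono (t k : ℕ) :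
    Fintype.card {c : Fin t → Fin k // StrictMono c} = k.choose t := by
  have e : {c : Fin t → Fin k // StrictMono c} ≃ Set.powersetCard (Fin k) t :=
    (Equiv.mk (fun c => OrderEmbedding.ofStrictMono c.1 c.2) (fun f => ⟨f, f.strictMono⟩)
      (fun _ => rfl) (fun _ => by ext; rfl)).trans Set.powersetCard.ofFinEmbEquiv
  rw [← Nat.card_eq_fintype_card, Nat.card_congr e, Set.powersetCard.card]
  simp

lemma card_interaction (t k v : ℕ) :
    (Fintype.card (Interaction t k v) : ℝ) = (k.choose t : ℝ) * (v : ℝ) ^ t := by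
  have : Fintype.card (Interaction t k v) = k.choose t * v ^ t := by
    rw [Fintype.card_prod, card_subtype_strictMono]; simp
  exact_mod_cast this

/-- Exponential generating bound for the overlaps of a fixed column set with all increasing
`t`-tuples of columns. -/
lemma sum_pow_inter_sub_one_le {t k : ℕ} (S : Finset (Fin k)) (hS : S.card = t) {y : ℝ}
    (hy : 1 ≤ y) :
    ∑ c : {c : Fin t → Fin k // StrictMono c}, (y ^ (S ∩ univ.image c.1).card - 1) ≤
      ((k : ℝ) + t * y) ^ t - (k : ℝ) ^ t := by
  have hcard : ∀ c : {c : Fin t → Fin k // StrictMono c}, y ^ (S ∩ univ.image c.1).card =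
      ∏ i, if c.1 i ∈ S then y else 1 := by
    intro c
    rw [prod_ite, prod_const, prod_const_one, mul_one]
    congr 1
    rw [← card_image_of_injective _ c.2.injective]
    congr 1
    ext x
    simp only [mem_inter, mem_image, mem_univ, true_and, mem_filter]
    constructor
    · rintro ⟨hx, i, rfl⟩; exact ⟨i, hx, rfl⟩
    · rintro ⟨i, hx, rfl⟩; exact ⟨hx, i, rfl⟩
  have hone : ∀ c : Fin t → Fin k, 1 ≤ ∏ i, if c i ∈ S then y else (1 : ℝ) := by
    intro c
    rw [prod_ite, prod_const, prod_const_one, mul_one]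
    exact one_le_pow₀ hy
  calc _ = ∑ c ∈ univ.filter (fun c : Fin t → Fin k => StrictMono c),
        ((∏ i, if c i ∈ S then y else (1 : ℝ)) - 1) := by
        rw [← sum_subtype_eq_sum_filter, subtype_univ]
        exact sum_congr rfl fun c _ => by rw [hcard c]
    _ ≤ ∑ c : Fin t → Fin k, ((∏ i, if c i ∈ S then y else (1 : ℝ)) - 1) :=
        sum_le_sum_of_subset_of_nonneg (filter_subset _ _) fun c _ _ => by linarith [hone c]
    _ = (∑ x : Fin k, if x ∈ S then y else (1 : ℝ)) ^ t - (k : ℝ) ^ t := by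
        rw [sum_sub_distrib, Fintype.sum_pow]
        simp
    _ ≤ _ := by
        have h1 : ∑ x : Fin k, (if x ∈ S then y else (1 : ℝ)) ≤ k + t * y := by
          calc _ ≤ ∑ x : Fin k, ((1 : ℝ) + if x ∈ S then y else 0) :=
                sum_le_sum fun x _ => by split_ifs <;> linarith
            _ = _ := by rw [sum_add_distrib, ← sum_filter]; simp [hS]
        have h0 : 0 ≤ ∑ x : Fin k, (if x ∈ S then y else (1 : ℝ)) :=
          sum_nonneg fun x _ => by split_ifs <;> linarith
        linarith [pow_le_pow_left₀ h0 h1 t]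

lemma sum_pow_overlap_le {t k v : ℕ} (ι : Interaction t k v) {y : ℝ} (hy : 1 ≤ y) :
    ∑ κ : Interaction t k v, y ^ (columns ι ∩ columns κ).card ≤
      (v : ℝ) ^ t * ((k.choose t : ℝ) + (((k : ℝ) + t * y) ^ t - (k : ℝ) ^ t)) := by
  have h := sum_pow_inter_sub_one_le (columns ι) (card_columns ι) hy
  rw [sum_sub_distrib, sum_const, card_univ, card_subtype_strictMono] at h
  rw [Fintype.sum_prod_type_right]
  simp only [columns] at h ⊢
  rw [sum_const, card_univ]
  simp only [nsmul_eq_mul, mul_one, Fintype.card_pi, Fintype.card_fin, prod_const, card_univ,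
    Nat.cast_pow] at h ⊢
  exact mul_le_mul_of_nonneg_left (by linarith) (by positivity)

/-- The number of uncovered interactions of an array. -/
noncomputable def uncoveredCount (t : ℕ) {k v n : ℕ} (A : Fin n → Fin k → Fin v) : ℝ :=
  ((univ.filter fun ι : Interaction t k v => Uncovered A ι).card : ℝ)

lemma uncoveredCount_eq_sum (t : ℕ) {k v n : ℕ} (A : Fin n → Fin k → Fin v) :
    uncoveredCount t A = ∑ ι : Interaction t k v, if Uncovered A ι then (1 : ℝ) else 0 := by
  simp [uncoveredCount]

lemma sum_uncoveredCount {t k v n : ℕ} (hv : 0 < v) :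
    ∑ A : Fin n → Fin k → Fin v, uncoveredCount t A =
      ((v : ℝ) ^ k) ^ n * ((k.choose t : ℝ) * (v : ℝ) ^ t * (1 - 1 / (v : ℝ) ^ t) ^ n) := by
  simp only [uncoveredCount_eq_sum]
  rw [sum_comm]
  simp only [sum_boole, card_arrays_uncovered hv]
  rw [sum_const, card_univ, nsmul_eq_mul, card_interaction]
  ring

lemma sum_uncoveredCount_sq_le {t k v n : ℕ} (ht : 0 < t) (hv : 2 ≤ v) {z : ℝ}
    (hz : 1 ≤ z) (hzq : z ^ t * (1 - 1 / (v : ℝ) ^ t) = 1) :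
    ∑ A : Fin n → Fin k → Fin v, uncoveredCount t A ^ 2 ≤
      ((v : ℝ) ^ k) ^ n * (((v : ℝ) ^ t * (1 - 1 / (v : ℝ) ^ t) ^ n) ^ 2 * (k.choose t : ℝ) *
        ((k.choose t : ℝ) + (((k : ℝ) + t * z ^ n) ^ t - (k : ℝ) ^ t))) := by
  have hz0 : 0 ≤ z := by linarith
  have hexp : ∀ A : Fin n → Fin k → Fin v, uncoveredCount t A ^ 2 =
      ∑ ι : Interaction t k v, ∑ κ : Interaction t k v,
        if Uncovered A ι ∧ Uncovered A κ then (1 : ℝ) else 0 := by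
    intro A
    rw [uncoveredCount_eq_sum, sq, sum_mul_sum]
    refine sum_congr rfl fun ι _ => sum_congr rfl fun κ _ => ?_
    by_cases h1 : Uncovered A ι <;> by_cases h2 : Uncovered A κ <;> simp [h1, h2]
  calc _ = ∑ ι : Interaction t k v, ∑ κ : Interaction t k v,
        ((univ.filter fun A : Fin n → Fin k → Fin v =>
          Uncovered A ι ∧ Uncovered A κ).card : ℝ) := by
        simp only [hexp]
        rw [sum_comm]
        refine sum_congr rfl fun ι _ => ?_
        rw [sum_comm]
        simp only [sum_boole]
    _ ≤ ∑ ι : Interaction t k v, ∑ κ : Interaction t k v,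
        ((v : ℝ) ^ k) ^ n * ((1 - 1 / (v : ℝ) ^ t) ^ n) ^ 2 *
        (z ^ n) ^ (columns ι ∩ columns κ).card :=
        sum_le_sum fun ι _ => sum_le_sum fun κ _ =>
          card_arrays_uncovered_both_le ht hv n hz0 hzq ι κ
    _ ≤ ∑ ι : Interaction t k v, ((v : ℝ) ^ k) ^ n * ((1 - 1 / (v : ℝ) ^ t) ^ n) ^ 2 *
        ((v : ℝ) ^ t * ((k.choose t : ℝ) + (((k : ℝ) + t * z ^ n) ^ t - (k : ℝ) ^ t))) := by
        refine sum_le_sum fun ι _ => ?_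
        rw [← mul_sum]
        exact mul_le_mul_of_nonneg_left (sum_pow_overlap_le ι (one_le_pow₀ hz)) (by positivity)
    _ = _ := by
        rw [sum_const, card_univ, nsmul_eq_mul, card_interaction]
        ring

/-- Chebyshev's inequality for the uniform distribution on a finite type, around `1`. -/
lemma card_abs_div_sub_one_gt_le {α : Type*} [Fintype α] [Nonempty α] (X : α → ℝ) {E ε M : ℝ}
    (hE : 0 < E) (hε : 0 < ε) (h1 : ∑ a, X a = Fintype.card α * E)
    (h2 : ∑ a, X a ^ 2 ≤ Fintype.card α * M) :
    ((univ.filter fun a => ε < |X a / E - 1|).card : ℝ) / Fintype.card α ≤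
      (M / E ^ 2 - 1) / ε ^ 2 := by
  have hN : (0 : ℝ) < Fintype.card α := by exact_mod_cast Fintype.card_pos
  have hsum : ((univ.filter fun a => ε < |X a / E - 1|).card : ℝ) * ε ^ 2 ≤
      ∑ a, (X a / E - 1) ^ 2 := by
    calc _ = ∑ a ∈ univ.filter (fun a => ε < |X a / E - 1|), ε ^ 2 := by
          rw [sum_const, nsmul_eq_mul]
      _ ≤ ∑ a ∈ univ.filter (fun a => ε < |X a / E - 1|), (X a / E - 1) ^ 2 := by
          refine sum_le_sum fun a ha => ?_
          rw [← sq_abs (X a / E - 1)]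
          exact pow_le_pow_left₀ hε.le (mem_filter.1 ha).2.le 2
      _ ≤ _ := sum_le_sum_of_subset_of_nonneg (filter_subset _ _) fun _ _ _ => sq_nonneg _
  have hexp : ∑ a, (X a / E - 1) ^ 2 =
      (∑ a, X a ^ 2) / E ^ 2 - 2 * (∑ a, X a) / E + Fintype.card α := by
    have : ∀ a, (X a / E - 1) ^ 2 = X a ^ 2 / E ^ 2 - 2 * X a / E + 1 := fun a => by ring
    simp only [this, sum_add_distrib, sum_sub_distrib, ← sum_div, ← mul_sum]
    simp
  rw [hexp, h1] at hsum
  rw [div_le_div_iff₀ hN (by positivity)]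
  have h3 : (∑ a, X a ^ 2) / E ^ 2 ≤ Fintype.card α * M / E ^ 2 := by gcongr
  have h4 : 2 * (Fintype.card α * E) / E = 2 * (Fintype.card α : ℝ) := by field_simp
  rw [h4] at hsum
  calc _ ≤ _ := hsum
    _ ≤ Fintype.card α * M / E ^ 2 - 2 * Fintype.card α + Fintype.card α := by linarith
    _ = _ := by ring

lemma pow_le_mul_choose {t k : ℕ} (ht : 0 < t) (hk : t ≤ k) :
    (k : ℝ) ^ t ≤ (t : ℝ) ^ t * t.factorial * k.choose t := by
  have h := Nat.pow_le_choose (α := ℝ) t k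
  rw [div_le_iff₀ (by positivity)] at h
  have h1 : k ≤ t * (k + 1 - t) := by
    obtain ⟨d, rfl⟩ := Nat.exists_eq_add_of_le hk
    rw [show t + d + 1 - t = d + 1 by omega]
    nlinarith
  calc (k : ℝ) ^ t ≤ ((t * (k + 1 - t) : ℕ) : ℝ) ^ t := by gcongr
    _ = (t : ℝ) ^ t * ((k + 1 - t : ℕ) : ℝ) ^ t := by rw [Nat.cast_mul, mul_pow]
    _ ≤ (t : ℝ) ^ t * (k.choose t * t.factorial) := by gcongr
    _ = _ := by ring

/-- Second moment concentration: if `n(k)` is chosen so that the expected number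
`E k = C(k,t)·v^t·(1−1/v^t)^{n k}` of uncovered interactions tends to infinity, then
the number of uncovered interactions in a random `n(k) × k` array, divided by `E k`,
tends to `1` in probability (probabilities expressed as counting ratios). -/
theorem uncovered_concentration (t v : ℕ) (ht : 2 ≤ t) (hv : 2 ≤ v) (n : ℕ → ℕ)
    (E : ℕ → ℝ)
    (hE : ∀ k, E k = (k.choose t : ℝ) * (v : ℝ) ^ t * (1 - 1 / (v : ℝ) ^ t) ^ (n k))
    (htend : Filter.Tendsto E Filter.atTop Filter.atTop) :
    ∀ ε : ℝ, 0 < ε →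
      Filter.Tendsto (fun k : ℕ =>
          ((Finset.univ.filter fun A : Fin (n k) → Fin k → Fin v =>
              ε < |((Finset.univ.filter fun ι : Interaction t k v =>
                Uncovered A ι).card : ℝ) / E k - 1|).card : ℝ) /
            (Fintype.card (Fin (n k) → Fin k → Fin v) : ℝ))
        Filter.atTop (nhds 0) := by
  intro ε hε
  have ht0 : 0 < t := by omega
  have hvR : (2 : ℝ) ≤ v := by exact_mod_cast hv
  have hvt : (2 : ℝ) ≤ (v : ℝ) ^ t := hvR.trans (le_self_pow₀ (by linarith) ht0.ne')
  have hp : 1 / (v : ℝ) ^ t ≤ 1 / 2 := one_div_le_one_div_of_le two_pos hvt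
  have hp0 : 0 < 1 / (v : ℝ) ^ t := by positivity
  set q := 1 - 1 / (v : ℝ) ^ t with hq
  have hq0 : 0 < q := by linarith
  obtain ⟨z, hz, hzq⟩ : ∃ z : ℝ, 1 ≤ z ∧ z ^ t * q = 1 := by
    refine ⟨(1 / q) ^ ((t : ℝ)⁻¹), Real.one_le_rpow ?_ (by positivity), ?_⟩
    · rw [le_div_iff₀ hq0]; linarith
    · rw [Real.rpow_inv_natCast_pow (by positivity) ht0.ne']; field_simp
  set K : ℝ := (t : ℝ) ^ t * t.factorial
  have hu : Filter.Tendsto (fun k => ((v : ℝ) ^ t / E k) ^ ((t : ℝ)⁻¹)) Filter.atTop (nhds 0) := by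
    have h := (htend.const_div_atTop ((v : ℝ) ^ t)).rpow_const
      (p := (t : ℝ)⁻¹) (Or.inr (by positivity))
    rwa [Real.zero_rpow (by positivity)] at h
  have hlim : Filter.Tendsto (fun k =>
      K * ((1 + t * ((v : ℝ) ^ t / E k) ^ ((t : ℝ)⁻¹)) ^ t - 1) / ε ^ 2)
      Filter.atTop (nhds 0) := by
    have h := (((((hu.const_mul (t : ℝ)).const_add 1).pow t).sub_const 1).const_mul K).div_const
      (ε ^ 2)
    simpa using h
  refine squeeze_zero' (Filter.Eventually.of_forall fun k => by positivity) ?_ hlim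
  filter_upwards [htend.eventually_gt_atTop 0, Filter.eventually_ge_atTop t] with k hEk hkt
  have hv0 : 0 < v := by omega
  have : NeZero v := ⟨hv0.ne'⟩
  have hN : (Fintype.card (Fin (n k) → Fin k → Fin v) : ℝ) = ((v : ℝ) ^ k) ^ n k := by simp
  have hch := card_abs_div_sub_one_gt_le
    (fun A : Fin (n k) → Fin k → Fin v => uncoveredCount t A) hEk hε
    (by rw [hN, sum_uncoveredCount hv0, hE k])
    (by rw [hN]; exact sum_uncoveredCount_sq_le ht0 hv hz hzq)
  refine le_trans hch ?_
  have hk0 : (0 : ℝ) < k := by exact_mod_cast (by omega : 0 < k)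
  have hC : (0 : ℝ) < k.choose t := by exact_mod_cast Nat.choose_pos hkt
  have hzn : 0 < z ^ n k := by positivity
  have hKC := pow_le_mul_choose ht0 hkt
  have hyk : z ^ n k / k ≤ ((v : ℝ) ^ t / E k) ^ ((t : ℝ)⁻¹) := by
    refine le_of_pow_le_pow_left₀ ht0.ne' (by positivity) ?_
    rw [Real.rpow_inv_natCast_pow (by positivity) ht0.ne', div_pow,
      div_le_div_iff₀ (by positivity) hEk, hE k]
    have h1 : (z ^ n k) ^ t * q ^ n k = 1 := by
      rw [← pow_mul, mul_comm (n k) t, pow_mul, ← mul_pow, hzq, one_pow]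
    have h2 : (k.choose t : ℝ) ≤ (k : ℝ) ^ t := by exact_mod_cast Nat.choose_le_pow k t
    calc (z ^ n k) ^ t * (k.choose t * (v : ℝ) ^ t * q ^ n k)
        = k.choose t * (v : ℝ) ^ t * ((z ^ n k) ^ t * q ^ n k) := by ring
      _ = k.choose t * (v : ℝ) ^ t := by rw [h1, mul_one]
      _ ≤ (v : ℝ) ^ t * (k : ℝ) ^ t := by rw [mul_comm]; gcongr
  refine div_le_div_of_nonneg_right ?_ (by positivity)
  have hD : ((k : ℝ) + t * z ^ n k) ^ t - (k : ℝ) ^ t =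
      (k : ℝ) ^ t * ((1 + t * (z ^ n k / k)) ^ t - 1) := by
    rw [mul_sub, ← mul_pow]; congr 2 <;> field_simp
  have hD0 : 0 ≤ (1 + t * (z ^ n k / k)) ^ t - 1 :=
    sub_nonneg.2 (one_le_pow₀ (le_add_of_nonneg_right (by positivity)))
  calc _ = (((k : ℝ) + t * z ^ n k) ^ t - (k : ℝ) ^ t) / k.choose t := by
        rw [hE k, ← hq]; field_simp; ring
    _ ≤ K * ((1 + t * (z ^ n k / k)) ^ t - 1) := by
        rw [hD, div_le_iff₀ hC]
        calc _ ≤ (K * k.choose t) * ((1 + t * (z ^ n k / k)) ^ t - 1) :=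
              mul_le_mul_of_nonneg_right hKC hD0
          _ = _ := by ring
    _ ≤ _ := by gcongr
end
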